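/- Let α, β, γ, δ, c, ε be real constants with γ ≠ 0. Suppose U, W : ℝ × ℝ → ℝ are four times continuously differentiable and satisfy the potential coupled Boussinesq system at every point. Then the local energy conservation law holds at every point: ∂_t( (1/2)[ U_t² + (δ/γ) W_t² + U_x² + (δc²/γ) W_x² + (ε/3)( U_x³ + (αδ/γ) W_x³ ) + ε U_tx² + (εβδ/γ) W_tx² + εδ (U − W)² ] ) − ∂_x( U_t U_x + (δc²/γ) W_t W_x + (ε/2) U_t U_x² + (εαδ/(2γ)) W_t W_x² + ε U_t U_ttx + (εβδ/γ) W_t W_ttx ) = 0. -/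

import Mathlib

/-- Partial derivative in the first variable (space `x`). -/
noncomputable def pd1 (f : ℝ → ℝ → ℝ) (x y : ℝ) : ℝ := deriv (fun x' => f x' y) x

/-- Partial derivative in the second variable (time `t`). -/
noncomputable def pd2 (f : ℝ → ℝ → ℝ) (x y : ℝ) : ℝ := deriv (fun y' => f x y') y

/-- The potential coupled Boussinesq system:
`U_tt − U_xx = ε[ U_x U_xx + U_ttxx − δ(U − W) ]`,
`W_tt − c² W_xx = ε[ α W_x W_xx + β W_ttxx + γ(U − W) ]`. -/
def potCB (α β γ δ c ε : ℝ) (U W : ℝ → ℝ → ℝ) : Prop :=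
  ∀ x t : ℝ,
    pd2 (pd2 U) x t - pd1 (pd1 U) x t
      = ε * (pd1 U x t * pd1 (pd1 U) x t + pd1 (pd1 (pd2 (pd2 U))) x t
          - δ * (U x t - W x t)) ∧
    pd2 (pd2 W) x t - c ^ 2 * pd1 (pd1 W) x t
      = ε * (α * pd1 W x t * pd1 (pd1 W) x t + β * pd1 (pd1 (pd2 (pd2 W))) x t
          + γ * (U x t - W x t))

section PartialDerivatives

variable {f : ℝ → ℝ → ℝ}

lemma hasDerivAt_fst_fderiv (hf : Differentiable ℝ (Function.uncurry f)) (x y : ℝ) :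
    HasDerivAt (fun x' => f x' y) (fderiv ℝ (Function.uncurry f) (x, y) (1, 0)) x :=
  HasFDerivAt.comp_hasDerivAt (f := fun x' => (x', y)) x (hf (x, y)).hasFDerivAt
    ((hasDerivAt_id x).prodMk (hasDerivAt_const x y))

lemma hasDerivAt_snd_fderiv (hf : Differentiable ℝ (Function.uncurry f)) (x y : ℝ) :
    HasDerivAt (fun y' => f x y') (fderiv ℝ (Function.uncurry f) (x, y) (0, 1)) y :=
  HasFDerivAt.comp_hasDerivAt (f := fun y' => (x, y')) y (hf (x, y)).hasFDerivAt
    ((hasDerivAt_const y x).prodMk (hasDerivAt_id y))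

lemma uncurry_pd1 (hf : Differentiable ℝ (Function.uncurry f)) :
    Function.uncurry (pd1 f) = fun p => fderiv ℝ (Function.uncurry f) p (1, 0) :=
  funext fun p => (hasDerivAt_fst_fderiv hf p.1 p.2).deriv

lemma uncurry_pd2 (hf : Differentiable ℝ (Function.uncurry f)) :
    Function.uncurry (pd2 f) = fun p => fderiv ℝ (Function.uncurry f) p (0, 1) :=
  funext fun p => (hasDerivAt_snd_fderiv hf p.1 p.2).deriv

lemma hasDerivAt_pd1 (hf : Differentiable ℝ (Function.uncurry f)) (x y : ℝ) :
    HasDerivAt (fun x' => f x' y) (pd1 f x y) x :=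
  (hasDerivAt_fst_fderiv hf x y).differentiableAt.hasDerivAt

lemma hasDerivAt_pd2 (hf : Differentiable ℝ (Function.uncurry f)) (x y : ℝ) :
    HasDerivAt (fun y' => f x y') (pd2 f x y) y :=
  (hasDerivAt_snd_fderiv hf x y).differentiableAt.hasDerivAt

lemma ContDiff.uncurry_pd1 {m n : WithTop ℕ∞} (hf : ContDiff ℝ n (Function.uncurry f))
    (hmn : m + 1 ≤ n) : ContDiff ℝ m (Function.uncurry (pd1 f)) := by
  have hn : n ≠ 0 := by rintro rfl; simp at hmn
  rw [_root_.uncurry_pd1 (hf.differentiable hn)]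
  exact (hf.fderiv_right hmn).clm_apply contDiff_const

lemma ContDiff.uncurry_pd2 {m n : WithTop ℕ∞} (hf : ContDiff ℝ n (Function.uncurry f))
    (hmn : m + 1 ≤ n) : ContDiff ℝ m (Function.uncurry (pd2 f)) := by
  have hn : n ≠ 0 := by rintro rfl; simp at hmn
  rw [_root_.uncurry_pd2 (hf.differentiable hn)]
  exact (hf.fderiv_right hmn).clm_apply contDiff_const

/-- Mixed second partial derivatives of a `C²` function agree. -/
lemma pd2_pd1_comm (hf : ContDiff ℝ 2 (Function.uncurry f)) :
    pd2 (pd1 f) = pd1 (pd2 f) := by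
  have hd : Differentiable ℝ (Function.uncurry f) := hf.differentiable two_ne_zero
  have h1 : Differentiable ℝ (Function.uncurry (pd1 f)) :=
    (hf.uncurry_pd1 (m := 1) (by norm_num)).differentiable one_ne_zero
  have h2 : Differentiable ℝ (Function.uncurry (pd2 f)) :=
    (hf.uncurry_pd2 (m := 1) (by norm_num)).differentiable one_ne_zero
  have hD : Differentiable ℝ (fderiv ℝ (Function.uncurry f)) :=
    (hf.fderiv_right (m := 1) (by norm_num)).differentiable one_ne_zero
  funext x y
  rw [show pd2 (pd1 f) x y = _ from congrFun (uncurry_pd2 h1) (x, y),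
    show pd1 (pd2 f) x y = _ from congrFun (uncurry_pd1 h2) (x, y),
    uncurry_pd1 hd, uncurry_pd2 hd, fderiv_clm_apply (hD _) (differentiableAt_const _),
    fderiv_clm_apply (hD _) (differentiableAt_const _)]
  simpa using (hf.contDiffAt.isSymmSndFDerivAt (by simp)).eq (0, 1) (1, 0)

end PartialDerivatives

/-- Local energy conservation law for C⁴ solutions of the potential coupled
Boussinesq system. -/
theorem stmt8 (α β γ δ c ε : ℝ) (hγ : γ ≠ 0) (U W : ℝ → ℝ → ℝ)
    (hU : ContDiff ℝ 4 (Function.uncurry U)) (hW : ContDiff ℝ 4 (Function.uncurry W))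
    (hsys : potCB α β γ δ c ε U W) :
    ∀ x t : ℝ,
      pd2 (fun x t => (1 / 2) * ((pd2 U x t) ^ 2 + (δ / γ) * (pd2 W x t) ^ 2
          + (pd1 U x t) ^ 2 + (δ * c ^ 2 / γ) * (pd1 W x t) ^ 2
          + (ε / 3) * ((pd1 U x t) ^ 3 + (α * δ / γ) * (pd1 W x t) ^ 3)
          + ε * (pd1 (pd2 U) x t) ^ 2 + (ε * β * δ / γ) * (pd1 (pd2 W) x t) ^ 2
          + ε * δ * (U x t - W x t) ^ 2)) x t
        - pd1 (fun x t => pd2 U x t * pd1 U x t + (δ * c ^ 2 / γ) * (pd2 W x t * pd1 W x t)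
            + (ε / 2) * pd2 U x t * (pd1 U x t) ^ 2
            + (ε * α * δ / (2 * γ)) * pd2 W x t * (pd1 W x t) ^ 2
            + ε * pd2 U x t * pd1 (pd2 (pd2 U)) x t
            + (ε * β * δ / γ) * pd2 W x t * pd1 (pd2 (pd2 W)) x t) x t
      = 0 := by
  intro x t
  have differentiability : ∀ V : ℝ → ℝ → ℝ, ContDiff ℝ 4 (Function.uncurry V) →
      Differentiable ℝ (Function.uncurry V) ∧ Differentiable ℝ (Function.uncurry (pd1 V)) ∧
      Differentiable ℝ (Function.uncurry (pd2 V)) ∧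
      Differentiable ℝ (Function.uncurry (pd1 (pd2 V))) ∧
      Differentiable ℝ (Function.uncurry (pd1 (pd2 (pd2 V)))) ∧
      pd2 (pd1 V) = pd1 (pd2 V) ∧ pd2 (pd1 (pd2 V)) = pd1 (pd2 (pd2 V)) := by
    intro V hV
    have h1 := hV.uncurry_pd1 (m := 3) (by norm_num)
    have h2 := hV.uncurry_pd2 (m := 3) (by norm_num)
    have h12 := h2.uncurry_pd1 (m := 2) (by norm_num)
    have h22 := h2.uncurry_pd2 (m := 2) (by norm_num)
    have h122 := h22.uncurry_pd1 (m := 1) (by norm_num)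
    exact ⟨hV.differentiable (by norm_num), h1.differentiable (by norm_num),
      h2.differentiable (by norm_num), h12.differentiable (by norm_num),
      h122.differentiable (by norm_num), pd2_pd1_comm (hV.of_le (by norm_num)),
      pd2_pd1_comm (h2.of_le (by norm_num))⟩
  obtain ⟨dU, dU1, dU2, dU12, dU122, sU, sU'⟩ := differentiability U hU
  obtain ⟨dW, dW1, dW2, dW12, dW122, sW, sW'⟩ := differentiability W hW
  have energy := ((((((((((hasDerivAt_pd2 dU2 x t).pow 2).add
    (((hasDerivAt_pd2 dW2 x t).pow 2).const_mul (δ / γ))).add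
    ((hasDerivAt_pd2 dU1 x t).pow 2)).add
    (((hasDerivAt_pd2 dW1 x t).pow 2).const_mul (δ * c ^ 2 / γ))).add
    ((((hasDerivAt_pd2 dU1 x t).pow 3).add
      (((hasDerivAt_pd2 dW1 x t).pow 3).const_mul (α * δ / γ))).const_mul (ε / 3))).add
    (((hasDerivAt_pd2 dU12 x t).pow 2).const_mul ε)).add
    (((hasDerivAt_pd2 dW12 x t).pow 2).const_mul (ε * β * δ / γ))).add
    ((((hasDerivAt_pd2 dU x t).sub (hasDerivAt_pd2 dW x t)).pow 2).const_mul
      (ε * δ))).const_mul (1 / 2)).deriv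
  have flux := ((((((((hasDerivAt_pd1 dU2 x t).mul (hasDerivAt_pd1 dU1 x t)).add
    (((hasDerivAt_pd1 dW2 x t).mul (hasDerivAt_pd1 dW1 x t)).const_mul (δ * c ^ 2 / γ))).add
    (((hasDerivAt_pd1 dU2 x t).const_mul (ε / 2)).mul ((hasDerivAt_pd1 dU1 x t).pow 2))).add
    (((hasDerivAt_pd1 dW2 x t).const_mul (ε * α * δ / (2 * γ))).mul
      ((hasDerivAt_pd1 dW1 x t).pow 2))).add
    (((hasDerivAt_pd1 dU2 x t).const_mul ε).mul (hasDerivAt_pd1 dU122 x t))).add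
    (((hasDerivAt_pd1 dW2 x t).const_mul (ε * β * δ / γ)).mul
      (hasDerivAt_pd1 dW122 x t)))).deriv
  refine (congrArg₂ (· - ·) energy flux).trans ?_
  obtain ⟨eqU, eqW⟩ := hsys x t
  simp only [sU, sU', sW, sW', Pi.pow_apply, Pi.sub_apply]
  have hδ : δ / γ * γ = δ := div_mul_cancel₀ δ hγ
  linear_combination pd2 U x t * eqU + δ / γ * pd2 W x t * eqW
    + ε * pd2 W x t * (U x t - W x t) * hδ
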